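/- arXiv:1711.06889 — 9 statements merged into one kernel-verified Lean document; each statement's English description precedes it below -/
import Mathlib

section
/- Let F be an infinite field and d ≥ 1. Let u = (A_1,…,A_d) and v = (B_1,…,B_d) be d-tuples of 2×2 matrices over F. Suppose that tr(A_i) = tr(B_i) and det(A_i) = det(B_i) for all 1 ≤ i ≤ d, that tr(A_i A_j) = tr(B_i B_j) for all 1 ≤ i < j ≤ d, and that tr(A_i A_j A_k) = tr(B_i B_j B_k) for all 1 ≤ i < j < k ≤ d. Then for every nonempty finite word w = (i_1,…,i_m) with letters in {1,…,d}, one has tr(A_{i_1}⋯A_{i_m}) = tr(B_{i_1}⋯B_{i_m}) and det(A_{i_1}⋯A_{i_m}) = det(B_{i_1}⋯B_{i_m}). (This is the separating property of the set S(d) in the main theorem: the algebra of invariants of d-tuples of 2×2 matrices under simultaneous conjugation is generated by traces and determinants of words in the matrices, so agreement on all of these is exactly non-separation.) -/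
open Matrix

namespace TwoByTwo

section CommRing

variable {R : Type*} [CommRing R]

theorem trace_mul_self (X : Matrix (Fin 2) (Fin 2) R) :
    (X * X).trace = X.trace ^ 2 - 2 * X.det := by
  simp only [trace_fin_two, det_fin_two, mul_apply, Fin.sum_univ_two]; ring

theorem trace_mul_self_mul (X Y : Matrix (Fin 2) (Fin 2) R) :
    (X * X * Y).trace = X.trace * (X * Y).trace - X.det * Y.trace := by
  simp only [trace_fin_two, det_fin_two, mul_apply, Fin.sum_univ_two]; ring

theorem trace_mul_mul_swap (X Y Z : Matrix (Fin 2) (Fin 2) R) :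
    (Y * X * Z).trace = X.trace * (Y * Z).trace + Y.trace * (X * Z).trace
      + Z.trace * (X * Y).trace - X.trace * Y.trace * Z.trace - (X * Y * Z).trace := by
  simp only [trace_fin_two, mul_apply, Fin.sum_univ_two]; ring

/-- Two families with the same traces, determinants and traces of increasing double products
have the same traces of all double products. -/
theorem trace_mul_eq {ι : Type*} [LinearOrder ι] {A B : ι → Matrix (Fin 2) (Fin 2) R}
    (hT : ∀ i, (A i).trace = (B i).trace) (hD : ∀ i, (A i).det = (B i).det)
    (hT2 : ∀ i j, i < j → (A i * A j).trace = (B i * B j).trace) (i j : ι) :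
    (A i * A j).trace = (B i * B j).trace := by
  rcases lt_trichotomy i j with h | rfl | h
  · exact hT2 i j h
  · rw [trace_mul_self, trace_mul_self, hT, hD]
  · rw [trace_mul_comm, trace_mul_comm (B i), hT2 j i h]

/-- Two families with the same traces, determinants and traces of increasing double and triple
products have the same traces of all triple products. -/
theorem trace_mul_mul_eq {ι : Type*} [LinearOrder ι] {A B : ι → Matrix (Fin 2) (Fin 2) R}
    (hT : ∀ i, (A i).trace = (B i).trace) (hD : ∀ i, (A i).det = (B i).det)
    (hT2 : ∀ i j, i < j → (A i * A j).trace = (B i * B j).trace)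
    (hT3 : ∀ i j k, i < j → j < k → (A i * A j * A k).trace = (B i * B j * B k).trace)
    (i j k : ι) : (A i * A j * A k).trace = (B i * B j * B k).trace := by
  have h2 := trace_mul_eq hT hD hT2
  have rot : ∀ i j k, (A i * A j * A k).trace = (B i * B j * B k).trace →
      (A j * A k * A i).trace = (B j * B k * B i).trace := by
    intro i j k h
    rwa [trace_mul_comm, trace_mul_comm (B j * B k), ← mul_assoc, ← mul_assoc]
  have swap : ∀ i j k, (A i * A j * A k).trace = (B i * B j * B k).trace →
      (A j * A i * A k).trace = (B j * B i * B k).trace := by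
    intro i j k h
    rw [trace_mul_mul_swap, trace_mul_mul_swap (B i), h, hT, hT, hT, h2, h2, h2]
  have rep : ∀ i k, (A i * A i * A k).trace = (B i * B i * B k).trace := by
    intro i k
    rw [trace_mul_self_mul, trace_mul_self_mul, hT, hT, hD, h2]
  rcases lt_trichotomy i j with hij | rfl | hij
  · rcases lt_trichotomy j k with hjk | rfl | hjk
    · exact hT3 i j k hij hjk
    · exact rot _ _ _ (rot _ _ _ (rep j i))
    · rcases lt_trichotomy i k with hik | rfl | hik
      · exact rot _ _ _ (swap _ _ _ (hT3 i k j hik hjk))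
      · exact rot _ _ _ (rep i j)
      · exact rot _ _ _ (hT3 k i j hik hij)
  · exact rep i k
  · rcases lt_trichotomy i k with hik | rfl | hik
    · exact swap _ _ _ (hT3 j i k hij hik)
    · exact rot _ _ _ (rep i j)
    · rcases lt_trichotomy j k with hjk | rfl | hjk
      · exact rot _ _ _ (rot _ _ _ (hT3 j k i hjk hik))
      · exact rot _ _ _ (rot _ _ _ (rep j i))
      · exact rot _ _ _ (rot _ _ _ (swap _ _ _ (hT3 k j i hjk hij)))

/-- Up to sign, the determinant of the coordinates of `1, X, Y, Z` in the basis of matrix units. -/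
def frameDet (X Y Z : Matrix (Fin 2) (Fin 2) R) : R :=
  (X * Y * Z).trace - (Y * X * Z).trace

/-- The coordinates with respect to `1, X, Y, Z`, up to the factor `frameDet X Y Z`. -/
theorem exists_frameDet_smul_eq (X Y Z M : Matrix (Fin 2) (Fin 2) R) :
    ∃ c : R, frameDet X Y Z • M = c • (1 : Matrix (Fin 2) (Fin 2) R)
      + frameDet Y Z M • X + frameDet Z X M • Y + frameDet X Y M • Z := by
  refine ⟨frameDet X Y Z * M 0 0 - frameDet Y Z M * X 0 0 - frameDet Z X M * Y 0 0
    - frameDet X Y M * Z 0 0, ?_⟩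
  ext i j
  fin_cases i <;> fin_cases j <;>
  · simp [frameDet, trace_fin_two, mul_apply, Fin.sum_univ_two]
    try ring

end CommRing

section Frame

variable {F : Type*} [Field F]

/-- If `e` spans, the trace form is nondegenerate on `e'`, and `e`, `e'` have the same structure
constants, then words agree as soon as their letters have the same coordinates. -/
theorem trace_prod_eq_of_span {ι κ : Type*} [Fintype κ] {A B : ι → Matrix (Fin 2) (Fin 2) F}
    {e e' : κ → Matrix (Fin 2) (Fin 2) F} (o : κ) (ho : e o = 1) (ho' : e' o = 1)
    (hspan : ∀ M, ∃ c : κ → F, M = ∑ i, c i • e i)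
    (hnondeg : ∀ N, (∀ j, (N * e' j).trace = 0) → N = 0)
    (h3 : ∀ i j k, (e i * e j * e k).trace = (e' i * e' j * e' k).trace)
    (hAB : ∀ i j, (A i * e j).trace = (B i * e' j).trace) (w : List ι) :
    (w.map A).prod.trace = (w.map B).prod.trace := by
  have h2 : ∀ i j, (e i * e j).trace = (e' i * e' j).trace := by
    intro i j
    have := h3 o i j
    rwa [ho, ho', one_mul, one_mul] at this
  have coord : ∀ M M' : Matrix (Fin 2) (Fin 2) F,
      (∀ j, (M * e j).trace = (M' * e' j).trace) →
      ∃ c : κ → F, M = ∑ i, c i • e i ∧ M' = ∑ i, c i • e' i := by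
    intro M M' h
    obtain ⟨c, hc⟩ := hspan M
    refine ⟨c, hc, sub_eq_zero.1 (hnondeg _ fun j => ?_)⟩
    rw [sub_mul, trace_sub, ← h j, hc, Finset.sum_mul, Finset.sum_mul, trace_sum, trace_sum,
      sub_eq_zero]
    exact Finset.sum_congr rfl fun i _ => by simp [h2]
  have key : ∀ w : List ι, ∀ j,
      ((w.map A).prod * e j).trace = ((w.map B).prod * e' j).trace := by
    intro w
    induction w with
    | nil =>
      intro j
      have := h2 o j
      rwa [ho, ho'] at this
    | cons a w ih =>
      intro j
      obtain ⟨c, hc, hc'⟩ := coord _ _ ih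
      obtain ⟨b, hb, hb'⟩ := coord _ _ (hAB a)
      rw [List.map_cons, List.map_cons, List.prod_cons, List.prod_cons, hc, hc', hb, hb']
      simp only [Finset.sum_mul, Finset.mul_sum, trace_sum, smul_mul_assoc, mul_smul_comm,
        trace_smul, h3]
  have := key w o
  rwa [ho, ho', mul_one, mul_one] at this

theorem exists_sum_smul_eq_of_frameDet_ne_zero {X Y Z : Matrix (Fin 2) (Fin 2) F}
    (h : frameDet X Y Z ≠ 0) (M : Matrix (Fin 2) (Fin 2) F) :
    ∃ c : Fin 4 → F, M = ∑ i, c i • (![1, X, Y, Z] : Fin 4 → Matrix (Fin 2) (Fin 2) F) i := by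
  obtain ⟨c, hc⟩ := exists_frameDet_smul_eq X Y Z M
  refine ⟨(frameDet X Y Z)⁻¹ • ![c, frameDet Y Z M, frameDet Z X M, frameDet X Y M], ?_⟩
  refine (inv_smul_smul₀ h M).symm.trans ?_
  rw [hc]
  simp [Fin.sum_univ_four, smul_smul, smul_add]

theorem eq_zero_of_frameDet_ne_zero {X Y Z : Matrix (Fin 2) (Fin 2) F}
    (h : frameDet X Y Z ≠ 0) (N : Matrix (Fin 2) (Fin 2) F)
    (hN : ∀ j, (N * (![1, X, Y, Z] : Fin 4 → Matrix (Fin 2) (Fin 2) F) j).trace = 0) :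
    N = 0 := by
  refine ext_iff_trace_mul_right.2 fun M => ?_
  obtain ⟨c, rfl⟩ := exists_sum_smul_eq_of_frameDet_ne_zero h M
  simp only [Finset.mul_sum, mul_smul_comm, trace_sum, trace_smul, hN]
  simp

/-- Words agree if the letters agree in trace against a nondegenerate frame `1, X, Y, Z`. -/
theorem trace_prod_eq_of_frame {ι : Type*} {A B : ι → Matrix (Fin 2) (Fin 2) F}
    {X Y Z X' Y' Z' : Matrix (Fin 2) (Fin 2) F} (h : frameDet X Y Z ≠ 0)
    (hX : X.trace = X'.trace) (hY : Y.trace = Y'.trace) (hZ : Z.trace = Z'.trace)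
    (dX : X.det = X'.det) (dY : Y.det = Y'.det) (dZ : Z.det = Z'.det)
    (hXY : (X * Y).trace = (X' * Y').trace) (hXZ : (X * Z).trace = (X' * Z').trace)
    (hYZ : (Y * Z).trace = (Y' * Z').trace) (hXYZ : (X * Y * Z).trace = (X' * Y' * Z').trace)
    (hA : ∀ i, (A i).trace = (B i).trace) (hAX : ∀ i, (A i * X).trace = (B i * X').trace)
    (hAY : ∀ i, (A i * Y).trace = (B i * Y').trace)
    (hAZ : ∀ i, (A i * Z).trace = (B i * Z').trace) (w : List ι) :
    (w.map A).prod.trace = (w.map B).prod.trace := by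
  have h' : frameDet X' Y' Z' ≠ 0 := by
    unfold frameDet at h ⊢
    rwa [trace_mul_mul_swap X', ← hX, ← hY, ← hZ, ← hXY, ← hXZ, ← hYZ, ← hXYZ, ← trace_mul_mul_swap]
  refine trace_prod_eq_of_span (e := ![1, X, Y, Z]) (e' := ![1, X', Y', Z']) 0 rfl rfl
    (exists_sum_smul_eq_of_frameDet_ne_zero h) (eq_zero_of_frameDet_ne_zero h')
    (trace_mul_mul_eq ?_ ?_ ?_ ?_) ?_ w
  · intro i; fin_cases i <;> simp [hX, hY, hZ]
  · intro i; fin_cases i <;> simp [dX, dY, dZ]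
  · intro i j hij; fin_cases i <;> fin_cases j <;> simp_all
  · intro i j k hij hjk; fin_cases i <;> fin_cases j <;> fin_cases k <;> simp_all
  · intro i j; fin_cases j <;> simp [hA, hAX, hAY, hAZ]

end Frame

section Triangular

variable {F : Type*} [Field F]

/-- Simultaneous conjugation of the family `A` to upper triangular form. -/
def Triangularizable {ι : Type*} (A : ι → Matrix (Fin 2) (Fin 2) F) : Prop :=
  ∃ P : (Matrix (Fin 2) (Fin 2) F)ˣ, ∀ i, (P⁻¹.val * A i * P.val) 1 0 = 0

theorem Triangularizable.of_conj {ι : Type*} {A : ι → Matrix (Fin 2) (Fin 2) F}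
    (P : (Matrix (Fin 2) (Fin 2) F)ˣ) (h : Triangularizable fun i => P⁻¹.val * A i * P.val) :
    Triangularizable A := by
  obtain ⟨Q, hQ⟩ := h
  refine ⟨P * Q, fun i => ?_⟩
  simpa [mul_assoc] using hQ i

theorem trace_conj (P : (Matrix (Fin 2) (Fin 2) F)ˣ) (X : Matrix (Fin 2) (Fin 2) F) :
    (P⁻¹.val * X * P.val).trace = X.trace := by
  rw [trace_mul_comm, ← mul_assoc, Units.mul_inv, one_mul]

theorem frameDet_conj (P : (Matrix (Fin 2) (Fin 2) F)ˣ) (X Y Z : Matrix (Fin 2) (Fin 2) F) :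
    frameDet (P⁻¹.val * X * P.val) (P⁻¹.val * Y * P.val) (P⁻¹.val * Z * P.val)
      = frameDet X Y Z := by
  have key : ∀ X Y Z : Matrix (Fin 2) (Fin 2) F,
      P⁻¹.val * X * P.val * (P⁻¹.val * Y * P.val) * (P⁻¹.val * Z * P.val)
        = P⁻¹.val * (X * Y * Z) * P.val := by
    intro X Y Z; simp [mul_assoc]
  rw [frameDet, key, key, trace_conj, trace_conj, frameDet]

/-- The matrix `[[0, 1], [1, 0]]` as a unit. -/
def swapUnit : (Matrix (Fin 2) (Fin 2) F)ˣ :=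
  ⟨!![0, 1; 1, 0], !![0, 1; 1, 0], by simp [one_fin_two], by simp [one_fin_two]⟩

/-- The matrix `[[1, 0], [s, 1]]` as a unit. -/
def lowerUnit (s : F) : (Matrix (Fin 2) (Fin 2) F)ˣ :=
  ⟨!![1, 0; s, 1], !![1, 0; -s, 1], by simp [one_fin_two], by simp [one_fin_two]⟩

/-- The matrix `[[1, s], [0, 1]]` as a unit. -/
def upperUnit (s : F) : (Matrix (Fin 2) (Fin 2) F)ˣ :=
  ⟨!![1, s; 0, 1], !![1, -s; 0, 1], by simp [one_fin_two], by simp [one_fin_two]⟩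

theorem swap_conj_one_zero (X : Matrix (Fin 2) (Fin 2) F) :
    ((swapUnit (F := F))⁻¹.val * X * (swapUnit (F := F)).val) 1 0 = X 0 1 := by
  simp [swapUnit, Units.inv_mk, mul_apply, vecMul, dotProduct, Fin.sum_univ_two]

theorem exists_conj_one_zero_eq_zero [IsAlgClosed F] (X : Matrix (Fin 2) (Fin 2) F) :
    ∃ P : (Matrix (Fin 2) (Fin 2) F)ˣ, (P⁻¹.val * X * P.val) 1 0 = 0 := by
  by_cases hb : X 0 1 = 0
  · exact ⟨swapUnit, by rw [swap_conj_one_zero, hb]⟩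
  · obtain ⟨s, hs⟩ := IsAlgClosed.exists_root
      (Polynomial.C (X 0 1) * Polynomial.X ^ 2 + Polynomial.C (X 0 0 - X 1 1) * Polynomial.X
        + Polynomial.C (- X 1 0)) (by rw [Polynomial.degree_quadratic hb]; decide)
    refine ⟨lowerUnit s, ?_⟩
    simp [Polynomial.IsRoot] at hs
    simp [lowerUnit, Units.inv_mk, mul_apply, vecMul, dotProduct, Fin.sum_univ_two]
    linear_combination -hs

theorem triangularizable_of_frameDet_eq_zero [IsAlgClosed F] {ι : Type*}
    {A : ι → Matrix (Fin 2) (Fin 2) F} (h3 : ∀ i j k, frameDet (A i) (A j) (A k) = 0)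
    (h2 : ∀ i j, frameDet (A i) (A j) (A i * A j) = 0) : Triangularizable A := by
  -- The three cases: a common nontrivial Jordan block, distinct eigenvalues, and scalars.
  have jordan : ∀ A : ι → Matrix (Fin 2) (Fin 2) F,
      (∀ i j, frameDet (A i) (A j) (A i * A j) = 0) → ∀ i, A i 1 0 = 0 → A i 0 0 = A i 1 1 →
      A i 0 1 ≠ 0 → Triangularizable A := by
    intro A h2 i h10 hd hb
    refine ⟨1, fun j => ?_⟩
    have := h2 i j
    simp only [frameDet, trace_fin_two, mul_apply, Fin.sum_univ_two, h10, hd] at this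
    have h : (A i 0 1 * A j 1 0) ^ 2 = 0 := by linear_combination this
    simpa [hb] using h
  have diag : ∀ A : ι → Matrix (Fin 2) (Fin 2) F,
      (∀ i j k, frameDet (A i) (A j) (A k) = 0) →
      (∀ i j, frameDet (A i) (A j) (A i * A j) = 0) → ∀ i, A i 1 0 = 0 → A i 0 1 = 0 →
      A i 0 0 ≠ A i 1 1 → Triangularizable A := by
    intro A h3 h2 i h10 h01 hne
    have hne' := sub_ne_zero.2 hne
    have key : ∀ j k, A j 0 1 * A k 1 0 = 0 := by
      have hjj : ∀ j, A j 0 1 * A j 1 0 = 0 := by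
        intro j
        have := h2 i j
        simp only [frameDet, trace_fin_two, mul_apply, Fin.sum_univ_two, h10, h01] at this
        have h : (A i 0 0 - A i 1 1) ^ 2 * (A j 0 1 * A j 1 0) = 0 := by
          linear_combination -this
        simpa [hne'] using h
      intro j k
      have := h3 i j k
      simp only [frameDet, trace_fin_two, mul_apply, Fin.sum_univ_two, h10, h01] at this
      have h : (A i 0 0 - A i 1 1) * (A j 0 1 * A k 1 0 - A k 0 1 * A j 1 0) = 0 := by
        linear_combination this
      have h' := sub_eq_zero.1 ((mul_eq_zero.1 h).resolve_left hne')
      have hsq : (A j 0 1 * A k 1 0) ^ 2 = 0 := by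
        linear_combination A j 0 1 * A k 1 0 * h' + A k 0 1 * A k 1 0 * hjj j
      simpa using hsq
    by_cases hall : ∀ j, A j 0 1 = 0
    · exact ⟨swapUnit, fun j => by rw [swap_conj_one_zero, hall]⟩
    · push Not at hall
      obtain ⟨j, hj⟩ := hall
      exact ⟨1, fun k => by simpa [hj] using key j k⟩
  by_cases hs : ∀ i, A i 1 0 = 0
  · exact ⟨1, by simpa using hs⟩
  push Not at hs
  obtain ⟨i, hi⟩ := hs
  obtain ⟨P, hP⟩ := exists_conj_one_zero_eq_zero (A i)
  refine .of_conj P ?_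
  have hmul : ∀ (P : (Matrix (Fin 2) (Fin 2) F)ˣ) (X Y : Matrix (Fin 2) (Fin 2) F),
      P⁻¹.val * X * P.val * (P⁻¹.val * Y * P.val) = P⁻¹.val * (X * Y) * P.val := by
    intro P X Y; simp [mul_assoc]
  have h3P : ∀ j k l, frameDet (P⁻¹.val * A j * P.val) (P⁻¹.val * A k * P.val)
      (P⁻¹.val * A l * P.val) = 0 := fun j k l => by rw [frameDet_conj, h3]
  have h2P : ∀ j k, frameDet (P⁻¹.val * A j * P.val) (P⁻¹.val * A k * P.val)
      (P⁻¹.val * A j * P.val * (P⁻¹.val * A k * P.val)) = 0 :=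
    fun j k => by rw [hmul, frameDet_conj, h2]
  have hscal : ∀ C : Matrix (Fin 2) (Fin 2) F, C 1 0 = 0 → C 0 1 = 0 → C 0 0 = C 1 1 →
      C = C 0 0 • (1 : Matrix (Fin 2) (Fin 2) F) := by
    intro C h10 h01 hd
    ext a b
    fin_cases a <;> fin_cases b <;> simp [h10, h01, hd]
  by_cases hd : (P⁻¹.val * A i * P.val) 0 0 = (P⁻¹.val * A i * P.val) 1 1
  · refine jordan _ h2P i hP hd fun hb => hi ?_
    have hX := hscal _ hP hb hd
    set c := (P⁻¹.val * A i * P.val) 0 0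
    have : A i = P.val * (P⁻¹.val * A i * P.val) * P⁻¹.val := by simp [mul_assoc]
    rw [this, hX]
    simp
  · have hd' := sub_ne_zero.2 hd
    set C := P⁻¹.val * A i * P.val with hC
    set s := - C 0 1 / (C 0 0 - C 1 1) with hs
    have hs' : s * (C 0 0 - C 1 1) = - C 0 1 := by rw [hs]; field_simp
    refine .of_conj (upperUnit s) (diag _ ?_ ?_ i ?_ ?_ ?_)
    · intro j k l; rw [frameDet_conj, h3P]
    · intro j k; rw [hmul, frameDet_conj, h2P]
    all_goals
      rw [← hC]
      simp [upperUnit, Units.inv_mk, mul_apply, vecMul, dotProduct, Fin.sum_univ_two, hP]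
    · linear_combination hs'
    · exact hd

theorem trace_prod_of_upper {ι : Type*} {A : ι → Matrix (Fin 2) (Fin 2) F}
    (h : ∀ i, A i 1 0 = 0) (w : List ι) :
    (w.map A).prod.trace
      = (w.map fun i => A i 0 0).prod + (w.map fun i => A i 1 1).prod := by
  have key : (w.map A).prod 1 0 = 0 ∧ (w.map A).prod 0 0 = (w.map fun i => A i 0 0).prod ∧
      (w.map A).prod 1 1 = (w.map fun i => A i 1 1).prod := by
    induction w with
    | nil => simp
    | cons a w ih =>
      obtain ⟨h1, h2, h3⟩ := ih
      simp [mul_apply, Fin.sum_univ_two, h, h1, h2, h3]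
  rw [trace_fin_two, key.2.1, key.2.2]

/-- A triangularizable family has the trace of a sum of two characters. -/
theorem Triangularizable.exists_characters {ι : Type*} {A : ι → Matrix (Fin 2) (Fin 2) F}
    (h : Triangularizable A) : ∃ a c : ι → F, (∀ i, (A i).det = a i * c i) ∧
      ∀ w : List ι, (w.map A).prod.trace = (w.map a).prod + (w.map c).prod := by
  obtain ⟨P, hP⟩ := h
  refine ⟨fun i => (P⁻¹.val * A i * P.val) 0 0, fun i => (P⁻¹.val * A i * P.val) 1 1,
    fun i => ?_, fun w => ?_⟩
  rotate_left
  · rw [← trace_prod_of_upper hP w]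
    have : (w.map fun i => P⁻¹.val * A i * P.val).prod = P⁻¹.val * (w.map A).prod * P.val := by
      induction w with
      | nil => simp
      | cons a w ih => simp only [List.map_cons, List.prod_cons, ih]; simp [mul_assoc]
    rw [this, trace_conj]
  · have : (P⁻¹.val * A i * P.val).det = (A i).det := by
      rw [det_mul_comm, ← mul_assoc, Units.mul_inv, one_mul]
    rw [← this, det_fin_two, hP]
    ring

/-- Unordered pairs of families are determined by their elementary symmetric functions and the
polarised power sums of degree two. -/
theorem eq_or_swap_of_symmetric {ι : Type*} {a c a' c' : ι → F}
    (h1 : ∀ i, a i + c i = a' i + c' i) (hd : ∀ i, a i * c i = a' i * c' i)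
    (h2 : ∀ i j, a i * a j + c i * c j = a' i * a' j + c' i * c' j) :
    (a = a' ∧ c = c') ∨ (a = c' ∧ c = a') := by
  have hroot : ∀ i, a i = a' i ∨ a i = c' i := by
    intro i
    have : (a i - a' i) * (a i - c' i) = 0 := by linear_combination a i * h1 i - hd i
    exact (mul_eq_zero.1 this).imp sub_eq_zero.1 sub_eq_zero.1
  by_cases hall : ∀ i, a' i = c' i
  · have ha : a = a' := funext fun i => (hroot i).elim id fun h => h.trans (hall i).symm
    exact .inl ⟨ha, funext fun i => by have := h1 i; rw [ha] at this; exact add_left_cancel this⟩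
  push Not at hall
  obtain ⟨i, hi⟩ := hall
  have hi' := sub_ne_zero.2 hi
  rcases hroot i with h | h
  · have hc : c i = c' i := by linear_combination h1 i - h
    have ha : a = a' := by
      funext j
      have := h2 i j
      rw [h, hc] at this
      refine mul_left_cancel₀ hi' ?_
      linear_combination this - c' i * h1 j
    exact .inl ⟨ha, funext fun j => by have := h1 j; rw [ha] at this; exact add_left_cancel this⟩
  · have hc : c i = a' i := by linear_combination h1 i - h
    have ha : a = c' := by
      funext j
      have := h2 i j
      rw [h, hc] at this
      refine mul_left_cancel₀ hi' ?_
      linear_combination a' i * h1 j - this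
    exact .inr ⟨ha, funext fun j => by have := h1 j; rw [ha] at this; linear_combination this⟩

theorem trace_prod_eq_of_triangularizable {ι : Type*} {A B : ι → Matrix (Fin 2) (Fin 2) F}
    (hA : Triangularizable A) (hB : Triangularizable B)
    (hT : ∀ i, (A i).trace = (B i).trace) (hD : ∀ i, (A i).det = (B i).det)
    (hT2 : ∀ i j, (A i * A j).trace = (B i * B j).trace) (w : List ι) :
    (w.map A).prod.trace = (w.map B).prod.trace := by
  obtain ⟨a, c, hd, hac⟩ := hA.exists_characters
  obtain ⟨a', c', hd', hac'⟩ := hB.exists_characters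
  have h := eq_or_swap_of_symmetric (a := a) (c := c) (a' := a') (c' := c')
    (fun i => by simpa using (hac [i]).symm.trans (by simpa [hT] using hac' [i]))
    (fun i => by rw [← hd, ← hd', hD])
    (fun i j => by simpa using (hac [i, j]).symm.trans (by simpa [hT2] using hac' [i, j]))
  rw [hac, hac']
  rcases h with ⟨rfl, rfl⟩ | ⟨rfl, rfl⟩
  · rfl
  · exact add_comm _ _

end Triangular

section Main

variable {F : Type*} [Field F]

theorem trace_prod_eq_of_exists_frame {ι : Type*} {A B : ι → Matrix (Fin 2) (Fin 2) F}
    (hT : ∀ i, (A i).trace = (B i).trace) (hD : ∀ i, (A i).det = (B i).det)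
    (h2 : ∀ i j, (A i * A j).trace = (B i * B j).trace)
    (h3 : ∀ i j k, (A i * A j * A k).trace = (B i * B j * B k).trace)
    (h : ¬ ((∀ i j k, frameDet (A i) (A j) (A k) = 0) ∧
      ∀ i j, frameDet (A i) (A j) (A i * A j) = 0)) (w : List ι) :
    (w.map A).prod.trace = (w.map B).prod.trace := by
  rw [not_and_or] at h
  push Not at h
  rcases h with ⟨i, j, k, h⟩ | ⟨i, j, h⟩
  · exact trace_prod_eq_of_frame h (hT i) (hT j) (hT k) (hD i) (hD j) (hD k) (h2 i j) (h2 i k)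
      (h2 j k) (h3 i j k) hT (h2 · i) (h2 · j) (h2 · k) w
  · refine trace_prod_eq_of_frame (X' := B i) (Y' := B j) (Z' := B i * B j) h (hT i) (hT j)
      (h2 i j) (hD i) (hD j) ?_ (h2 i j) ?_ ?_ ?_ hT (h2 · i) (h2 · j) ?_ w
    · rw [det_mul, det_mul, hD, hD]
    · rw [← mul_assoc, ← mul_assoc, h3]
    · rw [← mul_assoc, ← mul_assoc, h3]
    · rw [trace_mul_self, trace_mul_self, det_mul, det_mul, hD, hD, h2]
    · intro k
      rw [← mul_assoc, ← mul_assoc, h3]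

theorem trace_prod_eq_of_isAlgClosed [IsAlgClosed F] {ι : Type*}
    {A B : ι → Matrix (Fin 2) (Fin 2) F}
    (hT : ∀ i, (A i).trace = (B i).trace) (hD : ∀ i, (A i).det = (B i).det)
    (h2 : ∀ i j, (A i * A j).trace = (B i * B j).trace)
    (h3 : ∀ i j k, (A i * A j * A k).trace = (B i * B j * B k).trace) (w : List ι) :
    (w.map A).prod.trace = (w.map B).prod.trace := by
  by_cases hA : (∀ i j k, frameDet (A i) (A j) (A k) = 0) ∧
      ∀ i j, frameDet (A i) (A j) (A i * A j) = 0
  · by_cases hB : (∀ i j k, frameDet (B i) (B j) (B k) = 0) ∧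
        ∀ i j, frameDet (B i) (B j) (B i * B j) = 0
    · exact trace_prod_eq_of_triangularizable (triangularizable_of_frameDet_eq_zero hA.1 hA.2)
        (triangularizable_of_frameDet_eq_zero hB.1 hB.2) hT hD h2 w
    · exact (trace_prod_eq_of_exists_frame (fun i => (hT i).symm) (fun i => (hD i).symm)
        (fun i j => (h2 i j).symm) (fun i j k => (h3 i j k).symm) hB w).symm
  · exact trace_prod_eq_of_exists_frame hT hD h2 h3 hA w

theorem trace_prod_eq {ι : Type*} {A B : ι → Matrix (Fin 2) (Fin 2) F}
    (hT : ∀ i, (A i).trace = (B i).trace) (hD : ∀ i, (A i).det = (B i).det)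
    (h2 : ∀ i j, (A i * A j).trace = (B i * B j).trace)
    (h3 : ∀ i j k, (A i * A j * A k).trace = (B i * B j * B k).trace) (w : List ι) :
    (w.map A).prod.trace = (w.map B).prod.trace := by
  let f := algebraMap F (AlgebraicClosure F)
  have htr : ∀ M : Matrix (Fin 2) (Fin 2) F, (f.mapMatrix M).trace = f M.trace := by
    intro M; simp [trace_fin_two]
  have hprod : ∀ C : ι → Matrix (Fin 2) (Fin 2) F,
      (w.map fun i => f.mapMatrix (C i)).prod = f.mapMatrix (w.map C).prod := by
    intro C
    rw [map_list_prod, List.map_map]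
    rfl
  have key := trace_prod_eq_of_isAlgClosed (A := fun i => f.mapMatrix (A i))
    (B := fun i => f.mapMatrix (B i)) (fun i => by rw [htr, htr, hT])
    (fun i => by rw [← RingHom.map_det, ← RingHom.map_det, hD])
    (fun i j => by rw [← map_mul, ← map_mul, htr, htr, h2])
    (fun i j k => by simp only [← map_mul, htr, h3]) w
  rw [hprod, hprod, htr, htr] at key
  exact f.injective key

end Main

end TwoByTwo

theorem separating_property_S_d
    {F : Type*} [Field F] [Infinite F] {d : ℕ} (hd : 1 ≤ d)
    (A B : Fin d → Matrix (Fin 2) (Fin 2) F)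
    (hT : ∀ i : Fin d, (A i).trace = (B i).trace)
    (hD : ∀ i : Fin d, (A i).det = (B i).det)
    (hT2 : ∀ i j : Fin d, i < j → (A i * A j).trace = (B i * B j).trace)
    (hT3 : ∀ i j k : Fin d, i < j → j < k →
      (A i * A j * A k).trace = (B i * B j * B k).trace) :
    ∀ w : List (Fin d), w ≠ [] →
      (w.map A).prod.trace = (w.map B).prod.trace ∧
      (w.map A).prod.det = (w.map B).prod.det := by
  intro w _
  refine ⟨TwoByTwo.trace_prod_eq hT hD (TwoByTwo.trace_mul_eq hT hD hT2)
    (TwoByTwo.trace_mul_mul_eq hT hD hT2 hT3) w, ?_⟩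
  rw [← coe_detMonoidHom, map_list_prod, map_list_prod, List.map_map, List.map_map]
  exact congrArg List.prod (List.map_congr_left fun i _ => hD i)
end

section
/- Let F be an infinite field and d ≥ 1. For every function f belonging to the set S(d) (i.e., f is one of tr(X_i), det(X_i) for 1 ≤ i ≤ d, tr(X_i X_j) for 1 ≤ i < j ≤ d, or tr(X_i X_j X_k) for 1 ≤ i < j < k ≤ d), there exist d-tuples u, v ∈ M_2(F)^d such that g(u) = g(v) for every g ∈ S(d) with g ≠ f, while f(u) ≠ f(v). In other words, no proper subset of S(d) is a separating set, so S(d) is minimal by inclusion. -/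
open Matrix

/-- The set `S(d)` of invariant functions on `d`-tuples of `2 × 2` matrices:
traces and determinants of the single matrices, traces of products of two
matrices with increasing indices, and traces of products of three matrices
with increasing indices. -/
def matrixInvariantsS (F : Type*) [Field F] (d : ℕ) :
    Set ((Fin d → Matrix (Fin 2) (Fin 2) F) → F) :=
  {f | (∃ i : Fin d, f = fun A => (A i).trace) ∨
       (∃ i : Fin d, f = fun A => (A i).det) ∨
       (∃ i j : Fin d, i < j ∧ f = fun A => (A i * A j).trace) ∨
       (∃ i j k : Fin d, i < j ∧ j < k ∧ f = fun A => (A i * A j * A k).trace)}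

/-- The tuple with entries `A`, `B`, `C` at the places `i`, `j`, `k` and zeros elsewhere. -/
def tripleTuple {F : Type*} [Field F] {d : ℕ} (i j k : Fin d)
    (A B C : Matrix (Fin 2) (Fin 2) F) : Fin d → Matrix (Fin 2) (Fin 2) F :=
  fun l => if l = i then A else if l = j then B else if l = k then C else 0

theorem exists_tripleTuple_eq_zero {F : Type*} [Field F] {d : ℕ} {i j k a b c : Fin d}
    (A B C : Matrix (Fin 2) (Fin 2) F) (hij : i < j) (hjk : j < k) (hab : a < b) (hbc : b < c)
    (h : ¬(a = i ∧ b = j ∧ c = k)) :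
    tripleTuple i j k A B C a = 0 ∨ tripleTuple i j k A B C b = 0 ∨
      tripleTuple i j k A B C c = 0 := by
  have key : ∀ l, l ≠ i → l ≠ j → l ≠ k → tripleTuple i j k A B C l = 0 := by
    intro l h1 h2 h3
    simp [tripleTuple, h1, h2, h3]
  by_contra! hne
  have ha : a = i ∨ a = j ∨ a = k := by
    by_contra! h'
    exact hne.1 (key a h'.1 h'.2.1 h'.2.2)
  have hb : b = i ∨ b = j ∨ b = k := by
    by_contra! h'
    exact hne.2.1 (key b h'.1 h'.2.1 h'.2.2)
  have hc : c = i ∨ c = j ∨ c = k := by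
    by_contra! h'
    exact hne.2.2 (key c h'.1 h'.2.1 h'.2.2)
  omega

theorem S_d_minimal
    {F : Type*} [Field F] [Infinite F] {d : ℕ} (hd : 1 ≤ d) :
    ∀ f ∈ matrixInvariantsS F d,
      ∃ u v : Fin d → Matrix (Fin 2) (Fin 2) F,
        (∀ g ∈ matrixInvariantsS F d, g ≠ f → g u = g v) ∧ f u ≠ f v := by
  rintro f (⟨i, rfl⟩ | ⟨i, rfl⟩ | ⟨i, j, hij, rfl⟩ | ⟨i, j, k, hij, hjk, rfl⟩)
  · refine ⟨Pi.single i !![1, 0; 0, 0], 0, ?_, by simp [Matrix.trace_fin_two]⟩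
    rintro g (⟨a, rfl⟩ | ⟨a, rfl⟩ | ⟨a, b, hab, rfl⟩ | ⟨a, b, c, hab, hbc, rfl⟩) hg
    · have ha : a ≠ i := by rintro rfl; exact hg rfl
      simp [ha]
    · by_cases ha : a = i
      · subst ha; simp
      · simp [ha]
    · by_cases ha : a = i
      · have hb : b ≠ i := by omega
        simp [hb]
      · simp [ha]
    · by_cases ha : a = i
      · have hb : b ≠ i := by omega
        simp [hb]
      · simp [ha]
  · refine ⟨Pi.single i !![0, 1; -1, 0], 0, ?_, by simp⟩
    rintro g (⟨a, rfl⟩ | ⟨a, rfl⟩ | ⟨a, b, hab, rfl⟩ | ⟨a, b, c, hab, hbc, rfl⟩) hg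
    · by_cases ha : a = i
      · subst ha; simp [Matrix.trace_fin_two]
      · simp [ha]
    · have ha : a ≠ i := by rintro rfl; exact hg rfl
      simp [ha]
    · by_cases ha : a = i
      · have hb : b ≠ i := by omega
        simp [hb]
      · simp [ha]
    · by_cases ha : a = i
      · have hb : b ≠ i := by omega
        simp [hb]
      · simp [ha]
  · set u : Fin d → Matrix (Fin 2) (Fin 2) F :=
      fun l => if l = i then !![0, 1; 0, 0] else if l = j then !![0, 0; 1, 0] else 0 with hu
    have key : ∀ l, l ≠ i → l ≠ j → u l = 0 := by
      intro l h1 h2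
      simp [hu, h1, h2]
    refine ⟨u, 0, ?_, by simp [hu, hij.ne', Matrix.trace_fin_two]⟩
    rintro g (⟨a, rfl⟩ | ⟨a, rfl⟩ | ⟨a, b, hab, rfl⟩ | ⟨a, b, c, hab, hbc, rfl⟩) hg
    · simp only [hu]
      split_ifs <;> simp [Matrix.trace_fin_two]
    · simp only [hu]
      split_ifs <;> simp
    · have h : ¬(a = i ∧ b = j) := by rintro ⟨rfl, rfl⟩; exact hg rfl
      by_cases ha : a = i ∨ a = j
      · simp [key b (by omega) (by omega)]
      · simp [key a (by omega) (by omega)]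
    · by_cases ha : a = i ∨ a = j
      · by_cases hb : b = i ∨ b = j
        · simp [key c (by omega) (by omega)]
        · simp [key b (by omega) (by omega)]
      · simp [key a (by omega) (by omega)]
  · let u : Fin d → Matrix (Fin 2) (Fin 2) F :=
      tripleTuple i j k !![0, 1; 0, 0] !![0, 0; 1, 0] !![1, 0; 0, 0]
    refine ⟨u, fun l => (u l)ᵀ, ?_, by
      simp [u, tripleTuple, hij.ne', hjk.ne', (hij.trans hjk).ne', Matrix.trace_fin_two,
        Matrix.mul_apply]⟩
    rintro g (⟨a, rfl⟩ | ⟨a, rfl⟩ | ⟨a, b, hab, rfl⟩ | ⟨a, b, c, hab, hbc, rfl⟩) hg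
    · simp
    · simp
    · simp only [← Matrix.transpose_mul, Matrix.trace_transpose]
      exact Matrix.trace_mul_comm _ _
    · have h : ¬(a = i ∧ b = j ∧ c = k) := by rintro ⟨rfl, rfl, rfl⟩; exact hg rfl
      rcases exists_tripleTuple_eq_zero (F := F) !![0, 1; 0, 0] !![0, 0; 1, 0] !![1, 0; 0, 0]
        hij hjk hab hbc h with h0 | h0 | h0 <;> simp [u, h0]
end

section
/- Let F be an algebraically closed field. Let A_1, A_2, A_3, A_4 and B_1, B_2, B_3, B_4 be 2×2 matrices over F such that tr(A_i) = tr(B_i) and det(A_i) = det(B_i) for all 1 ≤ i ≤ 4, tr(A_i A_j) = tr(B_i B_j) for all 1 ≤ i < j ≤ 4, and tr(A_i A_j A_k) = tr(B_i B_j B_k) for all 1 ≤ i < j < k ≤ 4. Then tr(A_1 A_2 A_3 A_4) = tr(B_1 B_2 B_3 B_4). -/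
open Matrix

section TwoByTwoTraces

variable {F : Type*} [Field F]

/-- The trace of a product of three matrices, with the last two factors exchanged. -/
lemma trace_mul_swap (X Y Z : Matrix (Fin 2) (Fin 2) F) :
    (X * Z * Y).trace = -(X * Y * Z).trace + X.trace * (Y * Z).trace + Y.trace * (X * Z).trace
      + Z.trace * (X * Y).trace - X.trace * Y.trace * Z.trace := by
  simp only [trace_fin_two, mul_apply, Fin.sum_univ_two]
  ring

/-- The trace of a product of four matrices, with the two middle factors exchanged. -/
lemma trace_mul_swap_middle (X Y Z W : Matrix (Fin 2) (Fin 2) F) :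
    (X * Z * Y * W).trace = -(X * Y * Z * W).trace + Y.trace * (X * Z * W).trace
      + Z.trace * (X * Y * W).trace + ((Y * Z).trace - Y.trace * Z.trace) * (X * W).trace := by
  simp only [trace_fin_two, mul_apply, Fin.sum_univ_two]
  ring

/-- Twice the trace of a product of four matrices, in terms of traces of shorter products. -/
lemma two_mul_trace_mul_four (X Y Z W : Matrix (Fin 2) (Fin 2) F) :
    2 * (X * Y * Z * W).trace =
      X.trace * (Y * Z * W).trace + Y.trace * (X * Z * W).trace + Z.trace * (X * Y * W).trace
      + W.trace * (X * Y * Z).trace + (X * Y).trace * (Z * W).trace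
      - (X * Z).trace * (Y * W).trace + (X * W).trace * (Y * Z).trace
      - X.trace * Y.trace * (Z * W).trace - Y.trace * Z.trace * (X * W).trace
      - Z.trace * W.trace * (X * Y).trace - X.trace * W.trace * (Y * Z).trace
      + X.trace * Y.trace * Z.trace * W.trace := by
  simp only [trace_fin_two, mul_apply, Fin.sum_univ_two]
  ring

/-- The product of the traces of `X * Y * Z` and `X * Z * Y`. -/
lemma trace_mul_three_mul_trace_swap (X Y Z : Matrix (Fin 2) (Fin 2) F) :
    (X * Y * Z).trace * (X * Z * Y).trace =
      X.det * (Y * Z).trace ^ 2 + Y.det * (X * Z).trace ^ 2 + Z.det * (X * Y).trace ^ 2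
      + (X * Y).trace * (X * Z).trace * (Y * Z).trace
      - X.trace * Y.trace * Z.det * (X * Y).trace - X.trace * Z.trace * Y.det * (X * Z).trace
      - Y.trace * Z.trace * X.det * (Y * Z).trace
      + X.trace ^ 2 * Y.det * Z.det + Y.trace ^ 2 * X.det * Z.det + Z.trace ^ 2 * X.det * Y.det
      - 4 * X.det * Y.det * Z.det := by
  simp only [trace_fin_two, det_fin_two, mul_apply, Fin.sum_univ_two]
  ring

/-- Two triples with the same invariants of degree at most two have triple traces that are roots
of the same quadratic polynomial. -/
lemma trace_mul_three_eq_or_add_eq {X Y Z X' Y' Z' : Matrix (Fin 2) (Fin 2) F}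
    (hX : X.trace = X'.trace) (hY : Y.trace = Y'.trace) (hZ : Z.trace = Z'.trace)
    (dX : X.det = X'.det) (dY : Y.det = Y'.det) (dZ : Z.det = Z'.det)
    (hXY : (X * Y).trace = (X' * Y').trace) (hXZ : (X * Z).trace = (X' * Z').trace)
    (hYZ : (Y * Z).trace = (Y' * Z').trace) :
    (X * Y * Z).trace = (X' * Y' * Z').trace ∨
      (X * Y * Z).trace + (X' * Y' * Z').trace =
        X.trace * (Y * Z).trace + Y.trace * (X * Z).trace + Z.trace * (X * Y).trace
          - X.trace * Y.trace * Z.trace := by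
  have h := trace_mul_three_mul_trace_swap X Y Z
  have h' := trace_mul_three_mul_trace_swap X' Y' Z'
  rw [trace_mul_swap X Y Z] at h
  rw [trace_mul_swap X' Y' Z'] at h'
  rw [← hX, ← hY, ← hZ, ← dX, ← dY, ← dZ, ← hXY, ← hXZ, ← hYZ, ← h] at h'
  have key : ((X * Y * Z).trace - (X' * Y' * Z').trace) * ((X * Y * Z).trace +
      (X' * Y' * Z').trace - (X.trace * (Y * Z).trace + Y.trace * (X * Z).trace
        + Z.trace * (X * Y).trace - X.trace * Y.trace * Z.trace)) = 0 := by
    linear_combination h'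
  rcases mul_eq_zero.mp key with h0 | h0
  · exact Or.inl (sub_eq_zero.mp h0)
  · exact Or.inr (sub_eq_zero.mp h0)

/-- The alternating trilinear form `tr (X * Y * Z) - tr (X * Z * Y)`. -/
def traceAlt (X Y Z : Matrix (Fin 2) (Fin 2) F) : F :=
  (X * Y * Z).trace - (X * Z * Y).trace

lemma traceAlt_eq (X Y Z : Matrix (Fin 2) (Fin 2) F) :
    traceAlt X Y Z = 2 * (X * Y * Z).trace - X.trace * (Y * Z).trace - Y.trace * (X * Z).trace
      - Z.trace * (X * Y).trace + X.trace * Y.trace * Z.trace := by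
  rw [traceAlt, trace_mul_swap X Y Z]
  ring

lemma traceAlt_mul_trace_mul_four (X Y Z W : Matrix (Fin 2) (Fin 2) F) :
    traceAlt X Y Z * (X * Y * Z * W).trace =
      (X.trace * (Y * Z * W).trace + Y.trace * (X * Z * W).trace + Z.trace * W.trace * (X * Y).trace
        - X.trace * Y.trace * (Z * W).trace - W.trace * (X * Z * Y).trace
        - Z.trace * (X * W * Y).trace) * (X * Y * Z).trace
      - traceAlt Y Z W * X.det * (Y * Z).trace - traceAlt X Y W * Z.det * (X * Y).trace
      - traceAlt X Z W * ((X * Y).trace * (Y * Z).trace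
        - Y.det * (X.trace * Z.trace - (X * Z).trace)) := by
  simp only [traceAlt, trace_fin_two, det_fin_two, mul_apply, Fin.sum_univ_two]
  ring

/-- The relation in characteristic two that forces the sum of two candidate values for the trace of
a product of four matrices to vanish. -/
lemma eq_zero_of_two_eq_zero {a b c d ab ac ad bc bd cd t : F} (h2 : (2 : F) = 0)
    (habc : a * bc + b * ac + c * ab + a * b * c = 0)
    (habd : a * bd + b * ad + d * ab + a * b * d = 0)
    (hacd : a * cd + c * ad + d * ac + a * c * d = 0)
    (hbcd : b * cd + c * bd + d * bc + b * c * d = 0)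
    (ht : t = ab * cd + ac * bd + ad * bc + a * b * cd + b * c * ad + a * c * bd)
    (h0 : a = 0 → b = 0 → c = 0 → d = 0 → ab * cd + ac * bd + ad * bc = 0) : t = 0 := by
  have ha : a * t = 0 := by grind
  have hb : b * t = 0 := by grind
  have hc : c * t = 0 := by grind
  have hd : d * t = 0 := by grind
  grind

/-- Two families of matrices with the same determinants and the same traces of products of at most
three distinct members. -/
structure SameTraces {ι : Type*} (A B : ι → Matrix (Fin 2) (Fin 2) F) : Prop where
  trace (i : ι) : (A i).trace = (B i).trace
  det (i : ι) : (A i).det = (B i).det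
  pair {i j : ι} (hij : i ≠ j) : (A i * A j).trace = (B i * B j).trace
  triple {i j k : ι} (hij : i ≠ j) (hik : i ≠ k) (hjk : j ≠ k) :
    (A i * A j * A k).trace = (B i * B j * B k).trace

namespace SameTraces

variable {ι : Type*} {A B : ι → Matrix (Fin 2) (Fin 2) F} {i j k l : ι}

lemma traceAlt_eq (h : SameTraces A B) (hij : i ≠ j) (hik : i ≠ k) (hjk : j ≠ k) :
    traceAlt (A i) (A j) (A k) = traceAlt (B i) (B j) (B k) := by
  rw [traceAlt, traceAlt, h.triple hij hik hjk, h.triple hik hij hjk.symm]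

lemma trace_mul_four_eq_of_traceAlt_ne_zero (h : SameTraces A B) (hij : i ≠ j) (hik : i ≠ k)
    (hil : i ≠ l) (hjk : j ≠ k) (hjl : j ≠ l) (hkl : k ≠ l)
    (h0 : traceAlt (A i) (A j) (A k) ≠ 0) :
    (A i * A j * A k * A l).trace = (B i * B j * B k * B l).trace := by
  apply mul_left_cancel₀ h0
  rw [traceAlt_mul_trace_mul_four, h.traceAlt_eq hij hik hjk, traceAlt_mul_trace_mul_four]
  simp only [h.trace, h.det, h.pair hij, h.pair hik, h.pair hjk, h.pair hkl,
    h.triple hij hik hjk, h.triple hik hij hjk.symm, h.triple hjk hjl hkl, h.triple hik hil hkl,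
    h.triple hil hij hjl.symm, h.traceAlt_eq hjk hjl hkl, h.traceAlt_eq hij hil hjl,
    h.traceAlt_eq hik hil hkl]

lemma trace_mul_four_eq_or_add_eq (h : SameTraces A B) (hij : i ≠ j) (hik : i ≠ k)
    (hil : i ≠ l) (hjk : j ≠ k) (hjl : j ≠ l) (hkl : k ≠ l) :
    (A i * A j * A k * A l).trace = (B i * B j * B k * B l).trace ∨
      (A i * A j * A k * A l).trace + (B i * B j * B k * B l).trace =
        (A i).trace * (A j * A k * A l).trace + (A j).trace * (A i * A k * A l).trace
          + (A k * A l).trace * (A i * A j).trace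
          - (A i).trace * (A j).trace * (A k * A l).trace := by
  have := trace_mul_three_eq_or_add_eq (h.trace i) (h.trace j) (h.pair hkl) (h.det i) (h.det j)
    (by rw [det_mul, det_mul, h.det, h.det]) (h.pair hij)
    (by simpa only [mul_assoc] using h.triple hik hil hkl)
    (by simpa only [mul_assoc] using h.triple hjk hjl hkl)
  simpa only [mul_assoc] using this

lemma trace_mul_four_add_swap_middle_eq (h : SameTraces A B) (hij : i ≠ j) (hik : i ≠ k)
    (hil : i ≠ l) (hjk : j ≠ k) (hjl : j ≠ l) (hkl : k ≠ l) :
    (A i * A k * A j * A l).trace + (A i * A j * A k * A l).trace =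
      (B i * B k * B j * B l).trace + (B i * B j * B k * B l).trace := by
  rw [trace_mul_swap_middle (A i), trace_mul_swap_middle (B i)]
  simp only [h.trace, h.pair hil, h.pair hjk, h.triple hik hil hkl, h.triple hij hil hjl]
  ring

lemma trace_mul_four_eq (h : SameTraces A B) (hij : i ≠ j) (hik : i ≠ k)
    (hil : i ≠ l) (hjk : j ≠ k) (hjl : j ≠ l) (hkl : k ≠ l) :
    (A i * A j * A k * A l).trace = (B i * B j * B k * B l).trace := by
  have hL := two_mul_trace_mul_four (A i) (A j) (A k) (A l)
  have hL' := two_mul_trace_mul_four (B i) (B j) (B k) (B l)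
  rw [← h.trace, ← h.trace, ← h.trace, ← h.trace, ← h.pair hij, ← h.pair hik, ← h.pair hil,
    ← h.pair hjk, ← h.pair hjl, ← h.pair hkl, ← h.triple hij hik hjk, ← h.triple hij hil hjl,
    ← h.triple hik hil hkl, ← h.triple hjk hjl hkl, ← hL] at hL'
  by_cases h2 : (2 : F) = 0
  swap
  · exact (mul_left_cancel₀ h2 hL').symm
  have cyc (C : ι → Matrix (Fin 2) (Fin 2) F) (p q r s : ι) :
      (C p * C q * C r * C s).trace = (C s * C p * C q * C r).trace := by
    rw [trace_mul_comm]
    simp only [mul_assoc]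
  by_contra hne
  have hne₁ : (A l * A i * A j * A k).trace ≠ (B l * B i * B j * B k).trace := by
    rwa [cyc A, cyc B] at hne
  have hne₂ : (A k * A l * A i * A j).trace ≠ (B k * B l * B i * B j).trace := by
    rwa [cyc A, cyc B] at hne₁
  have hne₃ : (A j * A k * A l * A i).trace ≠ (B j * B k * B l * B i).trace := by
    rwa [cyc A, cyc B] at hne₂
  have hsub := h.trace_mul_four_add_swap_middle_eq hij hik hil hjk hjl hkl
  have hne₄ : (A i * A k * A j * A l).trace ≠ (B i * B k * B j * B l).trace := fun h4 =>
    hne (by linear_combination hsub - h4)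
  have d₁ := not_not.mp (mt (h.trace_mul_four_eq_of_traceAlt_ne_zero hij hik hil hjk hjl hkl) hne)
  have d₂ := not_not.mp (mt (h.trace_mul_four_eq_of_traceAlt_ne_zero hil.symm hjl.symm hkl.symm
    hij hik hjk) hne₁)
  have d₃ := not_not.mp (mt (h.trace_mul_four_eq_of_traceAlt_ne_zero hkl hik.symm hjk.symm
    hil.symm hjl.symm hij) hne₂)
  have d₄ := not_not.mp (mt (h.trace_mul_four_eq_of_traceAlt_ne_zero hjk hjl hij.symm hkl
    hik.symm hil.symm) hne₃)
  have q₁ := (h.trace_mul_four_eq_or_add_eq hij hik hil hjk hjl hkl).resolve_left hne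
  have q₂ := (h.trace_mul_four_eq_or_add_eq hjk hjl hij.symm hkl hik.symm
    hil.symm).resolve_left hne₃
  have q₃ := (h.trace_mul_four_eq_or_add_eq hik hij hil hjk.symm hkl hjl).resolve_left hne₄
  have e₃ : (A k * A j * A l).trace = (A j * A k * A l).trace := by
    rw [mul_assoc, trace_mul_comm]
    exact (sub_eq_zero.mp d₄).symm
  rw [cyc A, cyc B, trace_mul_cycle (A j) (A l) (A i), trace_mul_cycle (A k) (A l) (A i),
    trace_mul_comm (A l) (A i)] at q₂
  rw [e₃] at q₃
  simp only [_root_.traceAlt_eq, h2, zero_mul, trace_mul_comm (A l) (A i),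
    trace_mul_comm (A l) (A j), trace_mul_comm (A k) (A i)] at d₁ d₂ d₃ d₄
  rw [h2, zero_mul] at hL
  have hsum := eq_zero_of_two_eq_zero (t := (A i * A j * A k * A l).trace +
      (B i * B j * B k * B l).trace) (a := (A i).trace) (b := (A j).trace) (c := (A k).trace)
    (d := (A l).trace) (ab := (A i * A j).trace) (ac := (A i * A k).trace)
    (ad := (A i * A l).trace) (bc := (A j * A k).trace) (bd := (A j * A l).trace)
    (cd := (A k * A l).trace) h2 (by grind) (by grind) (by grind) (by grind) (by grind)
    (fun ha hb hc hd => by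
      rw [ha, hb, hc, hd] at hL
      grind)
  exact hne (by linear_combination hsum - (B i * B j * B k * B l).trace * h2)

end SameTraces

end TwoByTwoTraces

theorem prop4
    {F : Type*} [Field F] [IsAlgClosed F]
    (A B : Fin 4 → Matrix (Fin 2) (Fin 2) F)
    (hT : ∀ i : Fin 4, (A i).trace = (B i).trace)
    (hD : ∀ i : Fin 4, (A i).det = (B i).det)
    (hT2 : ∀ i j : Fin 4, i < j → (A i * A j).trace = (B i * B j).trace)
    (hT3 : ∀ i j k : Fin 4, i < j → j < k →
      (A i * A j * A k).trace = (B i * B j * B k).trace) :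
    (A 0 * A 1 * A 2 * A 3).trace = (B 0 * B 1 * B 2 * B 3).trace := by
  have pair {i j : Fin 4} (hij : i ≠ j) : (A i * A j).trace = (B i * B j).trace := by
    rcases lt_or_gt_of_ne hij with h | h
    · exact hT2 i j h
    · rw [trace_mul_comm, hT2 j i h, trace_mul_comm]
  have swap {i j k : Fin 4} (hij : i ≠ j) (hik : i ≠ k) (hjk : j ≠ k)
      (h : (A i * A j * A k).trace = (B i * B j * B k).trace) :
      (A i * A k * A j).trace = (B i * B k * B j).trace := by
    rw [trace_mul_swap (A i), trace_mul_swap (B i), h, pair hij, pair hik, pair hjk, hT, hT, hT]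
  have cycle {i j k : Fin 4} (h : (A i * A j * A k).trace = (B i * B j * B k).trace) :
      (A k * A i * A j).trace = (B k * B i * B j).trace := by
    rwa [trace_mul_cycle, trace_mul_cycle (B i)] at h
  have triple {i j k : Fin 4} (hij : i ≠ j) (hik : i ≠ k) (hjk : j ≠ k) :
      (A i * A j * A k).trace = (B i * B j * B k).trace := by
    rcases lt_or_gt_of_ne hij with h₁ | h₁ <;> rcases lt_or_gt_of_ne hjk with h₂ | h₂
    · exact hT3 i j k h₁ h₂
    · rcases lt_or_gt_of_ne hik with h₃ | h₃
      · exact swap hik hij hjk.symm (hT3 i k j h₃ h₂)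
      · exact cycle (cycle (hT3 k i j h₃ h₁))
    · rcases lt_or_gt_of_ne hik with h₃ | h₃
      · exact swap hik hij hjk.symm (cycle (cycle (hT3 j i k h₁ h₃)))
      · exact cycle (hT3 j k i h₂ h₃)
    · exact swap hik hij hjk.symm (cycle (hT3 k j i h₂ h₁))
  exact SameTraces.trace_mul_four_eq ⟨hT, hD, pair, triple⟩ (by decide) (by decide) (by decide)
    (by decide) (by decide) (by decide)
end

section
/- Let F be an algebraically closed field. Let A_1, A_2, A_3, A_4 and B_1, B_2, B_3, B_4 be 2×2 matrices over F such that tr(A_i) = tr(B_i) and det(A_i) = det(B_i) for all 1 ≤ i ≤ 4, tr(A_i A_j) = tr(B_i B_j) for all 1 ≤ i < j ≤ 4, and tr(A_i A_j A_k) = tr(B_i B_j B_k) for all 1 ≤ i < j < k ≤ 4. If A_1 = 0, then tr(A_1 A_2 A_3 A_4) = tr(B_1 B_2 B_3 B_4) (equivalently, tr(B_1 B_2 B_3 B_4) = 0). -/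
open Matrix

/-- If `N` is a nilpotent `2 × 2` matrix and `tr (N X) = 0`, then the row space of `N` is stable
under right multiplication by `X`, so that `N X` is a scalar multiple of `N`. -/
theorem exists_mul_eq_smul_of_trace_mul_eq_zero {F : Type*} [Field F]
    {N X : Matrix (Fin 2) (Fin 2) F} (ht : N.trace = 0) (hd : N.det = 0)
    (hX : (N * X).trace = 0) : ∃ c : F, N * X = c • N := by
  simp only [trace_fin_two, det_fin_two, mul_apply, Fin.sum_univ_two] at ht hd hX
  by_cases hb : N 0 1 = 0
  · by_cases hc : N 1 0 = 0
    · have h0 : N 0 0 = 0 := by grind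
      have h1 : N 1 1 = 0 := by grind
      refine ⟨0, ?_⟩
      ext i j
      fin_cases i <;> fin_cases j <;> simp [mul_apply, hb, hc, h0, h1]
    · refine ⟨(N * X) 1 0 / N 1 0, ?_⟩
      ext i j
      fin_cases i <;> fin_cases j <;> simp [mul_apply] <;> field_simp <;> grind
  · refine ⟨(N * X) 0 1 / N 0 1, ?_⟩
    ext i j
    fin_cases i <;> fin_cases j <;> simp [mul_apply] <;> field_simp <;> grind

theorem prop4_case_A1_zero
    {F : Type*} [Field F] [IsAlgClosed F]
    (A B : Fin 4 → Matrix (Fin 2) (Fin 2) F)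
    (hT : ∀ i : Fin 4, (A i).trace = (B i).trace)
    (hD : ∀ i : Fin 4, (A i).det = (B i).det)
    (hT2 : ∀ i j : Fin 4, i < j → (A i * A j).trace = (B i * B j).trace)
    (hT3 : ∀ i j k : Fin 4, i < j → j < k →
      (A i * A j * A k).trace = (B i * B j * B k).trace)
    (hA1 : A 0 = 0) :
    (A 0 * A 1 * A 2 * A 3).trace = (B 0 * B 1 * B 2 * B 3).trace := by
  have ht : (B 0).trace = 0 := by rw [← hT, hA1, trace_zero]
  have hd : (B 0).det = 0 := by rw [← hD, hA1, det_zero]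
  have key (j : Fin 4) (hj : 0 < j) : ∃ c : F, B 0 * B j = c • B 0 :=
    exists_mul_eq_smul_of_trace_mul_eq_zero ht hd (by simp [← hT2 0 j hj, hA1])
  obtain ⟨x, hx⟩ := key 1 (by decide)
  obtain ⟨y, hy⟩ := key 2 (by decide)
  obtain ⟨z, hz⟩ := key 3 (by decide)
  simp [hA1, hx, hy, hz, ht]
end

section
/- Let F be an algebraically closed field. Let A_1, A_2, A_3, A_4 and B_1, B_2, B_3, B_4 be 2×2 matrices over F such that tr(A_i) = tr(B_i) and det(A_i) = det(B_i) for all 1 ≤ i ≤ 4, tr(A_i A_j) = tr(B_i B_j) for all 1 ≤ i < j ≤ 4, and tr(A_i A_j A_k) = tr(B_i B_j B_k) for all 1 ≤ i < j < k ≤ 4. If both A_1 and B_1 are diagonal matrices, then tr(A_1 A_2 A_3 A_4) = tr(B_1 B_2 B_3 B_4). -/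
open Matrix

/-- If `A` and `B` have the same trace, and so do `D * A` and `D * B` for a nonscalar diagonal
`D`, then `A` and `B` have the same diagonal entries. -/
theorem diag_entries_eq_of_trace_eq {F : Type*} [Field F] {D A B : Matrix (Fin 2) (Fin 2) F}
    (hD : D.IsDiag) (hne : D 0 0 ≠ D 1 1) (h : A.trace = B.trace)
    (hDA : (D * A).trace = (D * B).trace) : A 0 0 = B 0 0 ∧ A 1 1 = B 1 1 := by
  have h01 : D 0 1 = 0 := hD (by decide)
  have h10 : D 1 0 = 0 := hD (by decide)
  simp only [trace_fin_two, mul_apply, Fin.sum_univ_two, h01, h10] at h hDA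
  have hne' := sub_ne_zero.mpr hne
  constructor
  · apply mul_left_cancel₀ hne'
    linear_combination hDA - D 1 1 * h
  · apply mul_left_cancel₀ hne'
    linear_combination D 0 0 * h - hDA

/-- Two quadruples with the same diagonal first matrix and the same traces of products of at most
three factors have the same trace of the full product. -/
theorem trace_mul_four_eq_of_eq_diag {F : Type*} [Field F]
    {D E A₁ A₂ A₃ B₁ B₂ B₃ : Matrix (Fin 2) (Fin 2) F} (hD : D.IsDiag) (hE : E = D)
    (t₁ : A₁.trace = B₁.trace) (t₂ : A₂.trace = B₂.trace) (t₃ : A₃.trace = B₃.trace)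
    (s₁ : (D * A₁).trace = (E * B₁).trace) (s₂ : (D * A₂).trace = (E * B₂).trace)
    (s₃ : (D * A₃).trace = (E * B₃).trace)
    (t₁₂ : (A₁ * A₂).trace = (B₁ * B₂).trace) (t₁₃ : (A₁ * A₃).trace = (B₁ * B₃).trace)
    (t₂₃ : (A₂ * A₃).trace = (B₂ * B₃).trace)
    (s₁₂ : (D * A₁ * A₂).trace = (E * B₁ * B₂).trace)
    (s₁₃ : (D * A₁ * A₃).trace = (E * B₁ * B₃).trace)
    (s₂₃ : (D * A₂ * A₃).trace = (E * B₂ * B₃).trace)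
    (t₁₂₃ : (A₁ * A₂ * A₃).trace = (B₁ * B₂ * B₃).trace) :
    (D * A₁ * A₂ * A₃).trace = (E * B₁ * B₂ * B₃).trace := by
  subst E
  have h01 : D 0 1 = 0 := hD (by decide)
  have h10 : D 1 0 = 0 := hD (by decide)
  by_cases hne : D 0 0 = D 1 1
  · simp only [trace_fin_two, mul_apply, Fin.sum_univ_two, h01, h10, hne] at t₁₂₃ ⊢
    linear_combination D 1 1 * t₁₂₃
  · rw [Matrix.mul_assoc, Matrix.mul_assoc] at s₁₂ s₁₃ s₂₃
    obtain ⟨x₁, w₁⟩ := diag_entries_eq_of_trace_eq hD hne t₁ s₁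
    obtain ⟨x₂, w₂⟩ := diag_entries_eq_of_trace_eq hD hne t₂ s₂
    obtain ⟨x₃, w₃⟩ := diag_entries_eq_of_trace_eq hD hne t₃ s₃
    obtain ⟨x₁₂, w₁₂⟩ := diag_entries_eq_of_trace_eq hD hne t₁₂ s₁₂
    obtain ⟨x₁₃, w₁₃⟩ := diag_entries_eq_of_trace_eq hD hne t₁₃ s₁₃
    obtain ⟨x₂₃, w₂₃⟩ := diag_entries_eq_of_trace_eq hD hne t₂₃ s₂₃
    simp only [mul_apply, Fin.sum_univ_two, x₁, w₁, x₂, w₂, x₃, w₃, add_right_inj,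
      add_left_inj] at x₁₂ w₁₂ x₁₃ w₁₃ x₂₃ w₂₃
    simp only [trace_fin_two, mul_apply, Fin.sum_univ_two, h01, h10, x₁, w₁, x₂, w₂, x₃, w₃]
    linear_combination D 0 0 * (B₁ 0 0 * x₂₃ + B₃ 0 0 * x₁₂ + B₂ 1 1 * x₁₃) +
      D 1 1 * (B₁ 1 1 * w₂₃ + B₃ 1 1 * w₁₂ + B₂ 0 0 * w₁₃)

theorem prop4_case_A1_B1_diagonal
    {F : Type*} [Field F] [IsAlgClosed F]
    (A B : Fin 4 → Matrix (Fin 2) (Fin 2) F)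
    (hT : ∀ i : Fin 4, (A i).trace = (B i).trace)
    (hD : ∀ i : Fin 4, (A i).det = (B i).det)
    (hT2 : ∀ i j : Fin 4, i < j → (A i * A j).trace = (B i * B j).trace)
    (hT3 : ∀ i j k : Fin 4, i < j → j < k →
      (A i * A j * A k).trace = (B i * B j * B k).trace)
    (hA1 : (A 0).IsDiag) (hB1 : (B 0).IsDiag) :
    (A 0 * A 1 * A 2 * A 3).trace = (B 0 * B 1 * B 2 * B 3).trace := by
  -- Up to conjugating `B` by a permutation matrix, `B 0` equals `A 0`.
  obtain ⟨e, he⟩ : ∃ e : Equiv.Perm (Fin 2), (B 0).submatrix e e = A 0 := by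
    have a01 : A 0 0 1 = 0 := hA1 (by decide)
    have a10 : A 0 1 0 = 0 := hA1 (by decide)
    have b01 : B 0 0 1 = 0 := hB1 (by decide)
    have b10 : B 0 1 0 = 0 := hB1 (by decide)
    have ht := hT 0
    have hd := hD 0
    simp only [trace_fin_two, det_fin_two, a01, a10, b01, b10] at ht hd
    have hroot : (A 0 0 0 - B 0 0 0) * (A 0 0 0 - B 0 1 1) = 0 := by
      linear_combination A 0 0 0 * ht - hd
    rcases mul_eq_zero.mp hroot with h | h
    · refine ⟨1, ?_⟩
      ext i j
      fin_cases i <;> fin_cases j <;> simp [a01, a10, b01, b10]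
      · linear_combination -h
      · linear_combination h - ht
    · refine ⟨Equiv.swap 0 1, ?_⟩
      ext i j
      fin_cases i <;> fin_cases j <;> simp [a01, a10, b01, b10]
      · linear_combination -h
      · linear_combination h - ht
  have htr (M : Matrix (Fin 2) (Fin 2) F) : (M.submatrix e e).trace = M.trace :=
    Equiv.sum_comp e fun i => M i i
  have key := trace_mul_four_eq_of_eq_diag (A₁ := A 1) (A₂ := A 2) (A₃ := A 3)
    (B₁ := (B 1).submatrix e e) (B₂ := (B 2).submatrix e e) (B₃ := (B 3).submatrix e e) hA1 he
  simp only [submatrix_mul_equiv, htr] at key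
  exact key (hT 1) (hT 2) (hT 3)
    (hT2 0 1 (by decide)) (hT2 0 2 (by decide)) (hT2 0 3 (by decide))
    (hT2 1 2 (by decide)) (hT2 1 3 (by decide)) (hT2 2 3 (by decide))
    (hT3 0 1 2 (by decide) (by decide)) (hT3 0 1 3 (by decide) (by decide))
    (hT3 0 2 3 (by decide) (by decide)) (hT3 1 2 3 (by decide) (by decide))
end

section
/- Let F be an algebraically closed field. Let A_1, A_2, A_3, A_4 and B_1, B_2, B_3, B_4 be 2×2 matrices over F such that tr(A_i) = tr(B_i) and det(A_i) = det(B_i) for all 1 ≤ i ≤ 4, tr(A_i A_j) = tr(B_i B_j) for all 1 ≤ i < j ≤ 4, and tr(A_i A_j A_k) = tr(B_i B_j B_k) for all 1 ≤ i < j < k ≤ 4. If A_1 is the Jordan block [[a, 1], [0, a]] for some a ∈ F and B_1 is a diagonal matrix, then tr(A_1 A_2 A_3 A_4) = tr(B_1 B_2 B_3 B_4). -/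
open Matrix

/-- A diagonal `2 × 2` matrix with the trace and determinant of a Jordan block is scalar. -/
theorem Matrix.IsDiag.eq_smul_one_of_trace_det {F : Type*} [Field F]
    {D : Matrix (Fin 2) (Fin 2) F} {a : F} (hD : D.IsDiag)
    (htr : D.trace = 2 * a) (hdet : D.det = a ^ 2) : D = a • 1 := by
  have h01 : D 0 1 = 0 := hD (by decide)
  have h10 : D 1 0 = 0 := hD (by decide)
  rw [trace_fin_two] at htr
  rw [det_fin_two, h01, h10] at hdet
  have h00 : D 0 0 = a := by
    have : (D 0 0 - a) ^ 2 = 0 := by linear_combination D 0 0 * htr - hdet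
    exact sub_eq_zero.mp (pow_eq_zero_iff two_ne_zero |>.mp this)
  have h11 : D 1 1 = a := by linear_combination htr - h00
  ext i j
  fin_cases i <;> fin_cases j <;> simp [h00, h01, h10, h11]

theorem Matrix.trace_jordan_fin_two_mul {F : Type*} [Field F] (a : F)
    (X : Matrix (Fin 2) (Fin 2) F) :
    (!![a, 1; 0, a] * X).trace = a * X.trace + X 1 0 := by
  simp only [trace_fin_two, mul_apply, Fin.sum_univ_two, of_apply, cons_val_zero, cons_val_one]
  ring

theorem prop4_case_A1_jordan_B1_diagonal
    {F : Type*} [Field F] [IsAlgClosed F]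
    (A B : Fin 4 → Matrix (Fin 2) (Fin 2) F)
    (hT : ∀ i : Fin 4, (A i).trace = (B i).trace)
    (hD : ∀ i : Fin 4, (A i).det = (B i).det)
    (hT2 : ∀ i j : Fin 4, i < j → (A i * A j).trace = (B i * B j).trace)
    (hT3 : ∀ i j k : Fin 4, i < j → j < k →
      (A i * A j * A k).trace = (B i * B j * B k).trace)
    (hA1 : ∃ a : F, A 0 = !![a, 1; 0, a])
    (hB1 : (B 0).IsDiag) :
    (A 0 * A 1 * A 2 * A 3).trace = (B 0 * B 1 * B 2 * B 3).trace := by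
  obtain ⟨a, hA⟩ := hA1
  have hB : B 0 = a • 1 := by
    refine hB1.eq_smul_one_of_trace_det ?_ ?_
    · rw [← hT, hA, trace_fin_two_of, two_mul]
    · rw [← hD, hA, det_fin_two_of]
      ring
  have lower : ∀ j : Fin 4, 0 < j → A j 1 0 = 0 := by
    intro j hj
    have h := hT2 0 j hj
    rw [hA, hB, trace_jordan_fin_two_mul, smul_mul_assoc, one_mul, trace_smul, smul_eq_mul,
      hT j] at h
    linear_combination h
  have hlow : (A 1 * A 2 * A 3) 1 0 = 0 := by
    simp [mul_apply, Fin.sum_univ_two, lower 1 (by decide), lower 2 (by decide),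
      lower 3 (by decide)]
  have h123 := hT3 1 2 3 (by decide) (by decide)
  rw [mul_assoc, mul_assoc, ← mul_assoc (A 1), mul_assoc (B 0 * B 1), mul_assoc (B 0),
    ← mul_assoc (B 1), hA, hB, trace_jordan_fin_two_mul, hlow, h123, smul_mul_assoc, one_mul,
    trace_smul, smul_eq_mul, add_zero]
end

section
/- Let F be an algebraically closed field, let A_1 = [[α_1, 1], [0, α_1]] for some α_1 ∈ F, and let A_2 = [[α_2, β_2], [γ_2, δ_2]] be a 2×2 matrix over F such that γ_2 ≠ 0 or α_2 ≠ δ_2. Then there exist an invertible matrix g ∈ GL_2(F) and elements c, d ∈ F such that g A_1 g^{-1} = A_1 and g A_2 g^{-1} = [[c, 0], [γ_2, d]]. -/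
open Matrix

theorem IsAlgClosed.exists_quadratic_eq_zero_of_ne_zero {F : Type*} [Field F] [IsAlgClosed F]
    {a b : F} (c : F) (h : a ≠ 0 ∨ b ≠ 0) : ∃ t : F, a * t ^ 2 + b * t + c = 0 := by
  by_cases ha : a = 0
  · have hb : b ≠ 0 := h.resolve_left (not_not_intro ha)
    exact ⟨-c / b, by subst ha; field_simp; ring⟩
  · obtain ⟨t, ht⟩ := IsAlgClosed.exists_root
      (Polynomial.C a * Polynomial.X ^ 2 + Polynomial.C b * Polynomial.X + Polynomial.C c)
      (by rw [Polynomial.degree_quadratic ha]; decide)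
    exact ⟨t, by simpa using ht⟩

theorem jordan_conjugation_lemma
    {F : Type*} [Field F] [IsAlgClosed F]
    (α₁ α₂ β₂ γ₂ δ₂ : F)
    (A₁ A₂ : Matrix (Fin 2) (Fin 2) F)
    (hA₁ : A₁ = !![α₁, 1; 0, α₁])
    (hA₂ : A₂ = !![α₂, β₂; γ₂, δ₂])
    (h : γ₂ ≠ 0 ∨ α₂ ≠ δ₂) :
    ∃ (g : GL (Fin 2) F) (c d : F),
      (g : Matrix (Fin 2) (Fin 2) F) * A₁ * (↑g⁻¹ : Matrix (Fin 2) (Fin 2) F) = A₁ ∧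
      (g : Matrix (Fin 2) (Fin 2) F) * A₂ * (↑g⁻¹ : Matrix (Fin 2) (Fin 2) F) =
        !![c, 0; γ₂, d] := by
  obtain ⟨t, ht⟩ := IsAlgClosed.exists_quadratic_eq_zero_of_ne_zero (a := γ₂) (b := α₂ - δ₂)
    (-β₂) (h.imp_right sub_ne_zero.mpr)
  subst hA₁ hA₂
  refine ⟨⟨!![1, t; 0, 1], !![1, -t; 0, 1], ?_, ?_⟩, α₂ + t * γ₂, δ₂ - t * γ₂, ?_, ?_⟩
  · simp [one_fin_two]
  · simp [one_fin_two]
  · ext i j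
    fin_cases i <;> fin_cases j <;> simp
    ring
  · ext i j
    fin_cases i <;> fin_cases j <;> simp
    · linear_combination -ht
    · ring
end

section
/- Let F be an infinite field. Let u = (A_1, A_2, A_3, A_4) and v = (B_1, B_2, B_3, B_4) be 4-tuples of 2×2 matrices over F such that tr(A_i) = tr(B_i) and det(A_i) = det(B_i) for all 1 ≤ i ≤ 4, tr(A_i A_j) = tr(B_i B_j) for all 1 ≤ i < j ≤ 4, and tr(A_i A_j A_k) = tr(B_i B_j B_k) for all 1 ≤ i < j < k ≤ 4. Then: (1) tr(A_i A_j A_k) = tr(B_i B_j B_k) for ALL pairwise distinct indices i, j, k ∈ {1,2,3,4} (in any order); and (2) if in addition tr(A_1 A_2 A_3 A_4) = tr(B_1 B_2 B_3 B_4), then for every permutation σ of {1,2,3,4} one has tr(A_{σ(1)} A_{σ(2)} A_{σ(3)} A_{σ(4)}) = tr(B_{σ(1)} B_{σ(2)} B_{σ(3)} B_{σ(4)}). -/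
open Matrix

/-- The trace form of the polarized Cayley–Hamilton identity for `2 × 2` matrices. -/
theorem Matrix.trace_mul_mul_add_trace_mul_mul_fin_two {R : Type*} [CommRing R]
    (X Y M : Matrix (Fin 2) (Fin 2) R) :
    (X * Y * M).trace + (Y * X * M).trace =
      X.trace * (Y * M).trace + Y.trace * (X * M).trace +
        ((X * Y).trace - X.trace * Y.trace) * M.trace := by
  simp only [Matrix.trace_fin_two, Matrix.mul_apply, Fin.sum_univ_two]
  ring

/-- Swapping the first two factors preserves equality of traces of words, provided the traces
of the shorter words agree. -/
theorem Matrix.trace_mul_mul_swap_eq_fin_two {R : Type*} [CommRing R]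
    {X Y M X' Y' M' : Matrix (Fin 2) (Fin 2) R}
    (hX : X.trace = X'.trace) (hY : Y.trace = Y'.trace) (hM : M.trace = M'.trace)
    (hXY : (X * Y).trace = (X' * Y').trace) (hXM : (X * M).trace = (X' * M').trace)
    (hYM : (Y * M).trace = (Y' * M').trace)
    (h : (X * Y * M).trace = (X' * Y' * M').trace) :
    (Y * X * M).trace = (Y' * X' * M').trace := by
  have e := Matrix.trace_mul_mul_add_trace_mul_mul_fin_two X Y M
  rw [hX, hY, hM, hXY, hXM, hYM, h,
    ← Matrix.trace_mul_mul_add_trace_mul_mul_fin_two X' Y' M'] at e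
  exact add_left_cancel e

theorem Matrix.trace_mul_cycle_four {n R : Type*} [Fintype n] [CommSemiring R]
    (X Y Z W : Matrix n n R) : (X * Y * Z * W).trace = (Y * Z * W * X).trace := by
  rw [Matrix.trace_mul_comm (Y * Z * W) X]
  simp only [Matrix.mul_assoc]

theorem trace_permutation_invariance
    {F : Type*} [Field F] [Infinite F]
    (A B : Fin 4 → Matrix (Fin 2) (Fin 2) F)
    (hT : ∀ i : Fin 4, (A i).trace = (B i).trace)
    (hD : ∀ i : Fin 4, (A i).det = (B i).det)
    (hT2 : ∀ i j : Fin 4, i < j → (A i * A j).trace = (B i * B j).trace)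
    (hT3 : ∀ i j k : Fin 4, i < j → j < k →
      (A i * A j * A k).trace = (B i * B j * B k).trace) :
    (∀ i j k : Fin 4, i ≠ j → i ≠ k → j ≠ k →
      (A i * A j * A k).trace = (B i * B j * B k).trace) ∧
    ((A 0 * A 1 * A 2 * A 3).trace = (B 0 * B 1 * B 2 * B 3).trace →
      ∀ σ : Equiv.Perm (Fin 4),
        (A (σ 0) * A (σ 1) * A (σ 2) * A (σ 3)).trace =
          (B (σ 0) * B (σ 1) * B (σ 2) * B (σ 3)).trace) := by
  have pair : ∀ i j : Fin 4, i ≠ j → (A i * A j).trace = (B i * B j).trace := by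
    intro i j hij
    rcases hij.lt_or_gt with h | h
    · exact hT2 i j h
    · rw [Matrix.trace_mul_comm (A i), Matrix.trace_mul_comm (B i)]
      exact hT2 j i h
  have rotate_three : ∀ i j k : Fin 4, (A i * A j * A k).trace = (B i * B j * B k).trace →
      (A j * A k * A i).trace = (B j * B k * B i).trace := by
    intro i j k h
    rwa [Matrix.trace_mul_cycle (A j), Matrix.trace_mul_cycle (B j)]
  have swap_three : ∀ i j k : Fin 4, i ≠ j → i ≠ k → j ≠ k →
      (A i * A j * A k).trace = (B i * B j * B k).trace →
      (A j * A i * A k).trace = (B j * B i * B k).trace := fun i j k hij hik hjk =>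
    Matrix.trace_mul_mul_swap_eq_fin_two (hT i) (hT j) (hT k) (pair i j hij) (pair i k hik)
      (pair j k hjk)
  have triple : ∀ i j k : Fin 4, i ≠ j → i ≠ k → j ≠ k →
      (A i * A j * A k).trace = (B i * B j * B k).trace := by
    intro i j k hij hik hjk
    rcases hij.lt_or_gt with h₁ | h₁ <;> rcases hik.lt_or_gt with h₂ | h₂ <;>
      rcases hjk.lt_or_gt with h₃ | h₃ <;> grind
  refine ⟨triple, fun h σ => ?_⟩
  have swap_four : ∀ i j k l : Fin 4, i ≠ j → i ≠ k → i ≠ l → j ≠ k → j ≠ l → k ≠ l →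
      (A i * A j * A k * A l).trace = (B i * B j * B k * B l).trace →
      (A j * A i * A k * A l).trace = (B j * B i * B k * B l).trace := by
    intro i j k l hij hik hil hjk hjl hkl h
    have e := triple i k l hik hil hkl
    have e' := triple j k l hjk hjl hkl
    rw [Matrix.mul_assoc _ (A k), Matrix.mul_assoc _ (B k)] at h e e' ⊢
    exact Matrix.trace_mul_mul_swap_eq_fin_two (hT i) (hT j) (pair k l hkl) (pair i j hij) e e' h
  have rotate_four : ∀ i j k l : Fin 4,
      (A i * A j * A k * A l).trace = (B i * B j * B k * B l).trace →
      (A j * A k * A l * A i).trace = (B j * B k * B l * B i).trace := by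
    intro i j k l h
    rwa [← Matrix.trace_mul_cycle_four (A i), ← Matrix.trace_mul_cycle_four (B i)]
  have hσ : σ ∈ Submonoid.closure
      (Set.range fun i : Fin 3 => Equiv.swap i.castSucc i.succ) := by
    rw [Equiv.Perm.mclosure_swap_castSucc_succ]
    trivial
  induction hσ using Submonoid.closure_induction_right with
  | one => exact h
  | mul_right τ _ s hs ih =>
    obtain ⟨i, rfl⟩ := hs
    have ne : ∀ a b : Fin 4, a ≠ b → τ a ≠ τ b := fun a b => τ.injective.ne
    fin_cases i
    · exact swap_four _ _ _ _ (ne 0 1 (by decide)) (ne 0 2 (by decide)) (ne 0 3 (by decide))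
        (ne 1 2 (by decide)) (ne 1 3 (by decide)) (ne 2 3 (by decide)) ih
    · have e := swap_four _ _ _ _ (ne 1 2 (by decide)) (ne 1 3 (by decide)) (ne 1 0 (by decide))
        (ne 2 3 (by decide)) (ne 2 0 (by decide)) (ne 3 0 (by decide)) (rotate_four _ _ _ _ ih)
      exact rotate_four _ _ _ _ (rotate_four _ _ _ _ (rotate_four _ _ _ _ e))
    · have e := swap_four _ _ _ _ (ne 2 3 (by decide)) (ne 2 0 (by decide)) (ne 2 1 (by decide))
        (ne 3 0 (by decide)) (ne 3 1 (by decide)) (ne 0 1 (by decide))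
        (rotate_four _ _ _ _ (rotate_four _ _ _ _ ih))
      exact rotate_four _ _ _ _ (rotate_four _ _ _ _ e)
end

section
/- Let F be an infinite field and d ≥ 1. Let u = (A_1,…,A_d) be a d-tuple of 2×2 matrices over F such that tr(A_i) = 0 and det(A_i) = 0 for all 1 ≤ i ≤ d, and such that for every k with 3 ≤ k ≤ 2d−1 the sum Σ_{i+j=k, i<j} tr(A_i A_j) (taken over pairs 1 ≤ i < j ≤ d with i + j = k) equals 0. Then u is not separated from the zero tuple by the invariant ring; concretely, for every nonempty finite word w = (i_1,…,i_m) with letters in {1,…,d}, one has tr(A_{i_1}⋯A_{i_m}) = 0 and det(A_{i_1}⋯A_{i_m}) = 0. (This expresses that the set {tr(X_i), det(X_i) (1 ≤ i ≤ d), Σ_{i+j=k, i<j} tr(X_i X_j) (3 ≤ k ≤ 2d−1)} is a 0-separating set for the matrix invariants of d-tuples of 2×2 matrices.) -/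
open Matrix

/-- Two nilpotent `2 × 2` matrices with traceless product are proportional. -/
theorem exists_eq_smul_of_trace_mul_eq_zero {F : Type*} [Field F]
    {N X : Matrix (Fin 2) (Fin 2) F} (hN : N ≠ 0)
    (hNt : N.trace = 0) (hNd : N.det = 0) (hXt : X.trace = 0) (hXd : X.det = 0)
    (h : (N * X).trace = 0) : ∃ c : F, X = c • N := by
  simp only [Matrix.trace_fin_two, Matrix.det_fin_two, Matrix.mul_apply, Fin.sum_univ_two] at *
  have hN1 : N 1 1 = -N 0 0 := by linear_combination hNt
  have hX1 : X 1 1 = -X 0 0 := by linear_combination hXt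
  rw [hN1] at hNd
  rw [hX1] at hXd
  rw [hN1, hX1] at h
  by_cases hb : N 0 1 = 0
  · have ha : N 0 0 = 0 := by
      apply pow_eq_zero_iff (n := 2) two_ne_zero |>.1
      linear_combination -hNd - N 1 0 * hb
    have hc : N 1 0 ≠ 0 := by
      intro hc
      apply hN
      ext i j
      fin_cases i <;> fin_cases j <;> simp [ha, hb, hc, hN1]
    have hy : X 0 1 = 0 := by
      simpa [ha, hb, hc] using h
    have hx : X 0 0 = 0 := by
      apply pow_eq_zero_iff (n := 2) two_ne_zero |>.1
      linear_combination -hXd - X 1 0 * hy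
    refine ⟨X 1 0 / N 1 0, ?_⟩
    ext i j
    fin_cases i <;> fin_cases j <;> simp [ha, hb, hc, hN1, hX1, hx, hy]
  · have hx : N 0 1 * X 0 0 = N 0 0 * X 0 1 := by
      rw [← sub_eq_zero]
      apply pow_eq_zero_iff (n := 2) two_ne_zero |>.1
      linear_combination -(N 0 1) ^ 2 * hXd - (X 0 1) ^ 2 * hNd - N 0 1 * X 0 1 * h
    have hz : N 0 1 * X 1 0 = N 1 0 * X 0 1 := by
      apply mul_left_cancel₀ hb
      linear_combination N 0 1 * h - 2 * N 0 0 * hx + 2 * X 0 1 * hNd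
    refine ⟨X 0 1 / N 0 1, ?_⟩
    ext i j
    fin_cases i <;> fin_cases j <;> simp [hN1, hX1] <;> field_simp
    · linear_combination hx
    · linear_combination hz
    · linear_combination hx

/-- A square-zero matrix spans a line closed under nonempty products. -/
theorem exists_list_prod_eq_smul {ι R n : Type*} [CommRing R] [Fintype n] [DecidableEq n]
    {A : ι → Matrix n n R} {N : Matrix n n R} (hNN : N * N = 0)
    (hA : ∀ i, ∃ c : R, A i = c • N) :
    ∀ w : List ι, w ≠ [] → ∃ c : R, (w.map A).prod = c • N
  | [], h => absurd rfl h
  | [i], _ => by simpa using hA i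
  | i :: j :: w, _ => by
    obtain ⟨c, hc⟩ := hA i
    obtain ⟨s, hs⟩ := exists_list_prod_eq_smul hNN hA (j :: w) (List.cons_ne_nil _ _)
    refine ⟨0, ?_⟩
    rw [List.map_cons, List.prod_cons, hs, hc]
    simp [hNN]

theorem zero_separating_set
    {F : Type*} [Field F] [Infinite F] {d : ℕ} (hd : 1 ≤ d)
    (A : Fin d → Matrix (Fin 2) (Fin 2) F)
    (hT : ∀ i : Fin d, (A i).trace = 0)
    (hD : ∀ i : Fin d, (A i).det = 0)
    (hS : ∀ k : ℕ, 3 ≤ k → k ≤ 2 * d - 1 →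
      ∑ i : Fin d, ∑ j : Fin d,
        (if i < j ∧ ((i : ℕ) + 1) + ((j : ℕ) + 1) = k
          then (A i * A j).trace else 0) = 0) :
    ∀ w : List (Fin d), w ≠ [] →
      (w.map A).prod.trace = 0 ∧ (w.map A).prod.det = 0 := by
  classical
  suffices h : ∃ N : Matrix (Fin 2) (Fin 2) F, N.trace = 0 ∧ N.det = 0 ∧
      ∀ i, ∃ c : F, A i = c • N by
    obtain ⟨N, hNt, hNd, hA⟩ := h
    have hNN : N * N = 0 := by
      rw [Matrix.trace_fin_two] at hNt
      rw [Matrix.det_fin_two] at hNd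
      ext i j
      fin_cases i <;> fin_cases j <;> simp [Matrix.mul_apply, Fin.sum_univ_two]
      · linear_combination N 0 0 * hNt - hNd
      · linear_combination N 0 1 * hNt
      · linear_combination N 1 0 * hNt
      · linear_combination N 1 1 * hNt - hNd
    intro w hw
    obtain ⟨c, hc⟩ := exists_list_prod_eq_smul hNN hA w hw
    simp [hc, hNt, hNd]
  by_cases h0 : ∀ i, A i = 0
  · exact ⟨0, by simp, by simp, fun i => ⟨0, by simp [h0]⟩⟩
  push Not at h0
  obtain ⟨r, hr, hmin⟩ := WellFounded.has_min (wellFounded_lt (α := Fin d)) {i | A i ≠ 0} h0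
  have hlt : ∀ i, i < r → A i = 0 := fun i hi => by
    by_contra hne
    exact hmin i hne hi
  refine ⟨A r, hT r, hD r, fun m => ?_⟩
  have hrr : (A r * A r).trace = 0 := by
    have ht := hT r
    have hd' := hD r
    rw [Matrix.trace_fin_two] at ht
    rw [Matrix.det_fin_two] at hd'
    simp only [Matrix.trace_fin_two, Matrix.mul_apply, Fin.sum_univ_two]
    linear_combination (A r 0 0 + A r 1 1) * ht - 2 * hd'
  induction m using WellFoundedLT.induction with
  | ind m ih =>
    rcases lt_trichotomy m r with hm | rfl | hm
    · exact ⟨0, by simp [hlt m hm]⟩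
    · exact ⟨1, by simp⟩
    · apply exists_eq_smul_of_trace_mul_eq_zero hr (hT r) (hD r) (hT m) (hD m)
      have hm' : (r : ℕ) < m := hm
      have hs := hS (r + 1 + (m + 1)) (by omega) (by omega)
      rw [Finset.sum_eq_single r, Finset.sum_eq_single m] at hs
      · simpa [hm] using hs
      · intro j _ hj
        rw [if_neg]
        rintro ⟨-, h⟩
        exact hj (Fin.ext (by omega))
      · simp
      · intro i _ hi
        refine Finset.sum_eq_zero fun j _ => ?_
        split_ifs with h
        · rcases lt_or_gt_of_ne hi with hir | hir
          · simp [hlt i hir]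
          · have hir' : (r : ℕ) < i := hir
            have hij : (i : ℕ) < j := h.1
            obtain ⟨c, hc⟩ := ih i (Fin.lt_def.2 (by omega))
            obtain ⟨e, he⟩ := ih j (Fin.lt_def.2 (by omega))
            simp [hc, he, hrr]
        · rfl
      · simp
end
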